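/- arXiv:2601.13958 — 10 statements merged into one kernel-verified Lean document; each statement's English description precedes it below -/
import Mathlib

section
/- Let g > 0 and α < 0 be real numbers, and let J be the 5×5 real matrix whose only nonzero entries are J(1,3) = J(2,4) = −g/α and J(3,1) = J(4,2) = 1. Then the real number √(−g/α) is strictly positive and is an eigenvalue of J, i.e. det(J − √(−g/α)·I₅) = 0. In particular J has an eigenvalue with strictly positive real part, so the linearized zero dynamics are unstable when the controlled output lies below the combined center of gravity. -/
/-- For `α < 0`, the Jacobian of the linearized zero dynamics of the UAV-with-payload
model has the strictly positive real eigenvalue `√(-g/α)`, hence an eigenvalue with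
strictly positive real part: the linearized zero dynamics are unstable when the
controlled output lies below the combined center of gravity. -/
theorem zero_dynamics_unstable_below (g α : ℝ) (hg : 0 < g) (hα : α < 0)
    (J : Matrix (Fin 5) (Fin 5) ℝ)
    (hJ : J = !![0, 0, -g/α, 0, 0;
                 0, 0, 0, -g/α, 0;
                 1, 0, 0, 0, 0;
                 0, 1, 0, 0, 0;
                 0, 0, 0, 0, 0]) :
    0 < Real.sqrt (-g/α) ∧
      (J - Real.sqrt (-g/α) • (1 : Matrix (Fin 5) (Fin 5) ℝ)).det = 0 := by
  have hc : 0 < -g / α := div_pos_of_neg_of_neg (neg_neg_of_pos hg) hα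
  refine ⟨Real.sqrt_pos.mpr hc, ?_⟩
  have hs := Real.mul_self_sqrt hc.le
  subst hJ
  generalize -g / α = c at hs ⊢
  generalize Real.sqrt c = s at hs ⊢
  refine Matrix.exists_mulVec_eq_zero_iff.mp ⟨![s, 0, 1, 0, 0], fun h => ?_, ?_⟩
  · simpa using congrFun h 2
  · rw [Matrix.sub_mulVec, Matrix.smul_mulVec, Matrix.one_mulVec, sub_eq_zero]
    ext i
    fin_cases i <;> simp [Matrix.mulVec, dotProduct, Fin.sum_univ_five, hs]
end

section
/- Let g > 0 and α > 0 be real numbers, and let J be the 5×5 real matrix whose only nonzero entries are J(1,3) = J(2,4) = −g/α and J(3,1) = J(4,2) = 1. Then every complex eigenvalue z of J (i.e. every z ∈ ℂ with det(J − z·I₅) = 0, viewing J as a complex matrix) has real part equal to 0; the eigenvalues are exactly 0 and ±i·√(g/α). Hence the linearized zero dynamics are marginally stable when the controlled output lies above the combined center of gravity. -/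
/-- The characteristic determinant of the Jacobian with coupling coefficient `-c`. -/
lemma det_zero_dynamics_jacobian_sub_smul_one {R : Type*} [CommRing R] (c z : R) :
    (!![0, 0, -c, 0, 0;
        0, 0, 0, -c, 0;
        1, 0, 0, 0, 0;
        0, 1, 0, 0, 0;
        0, 0, 0, 0, 0] - z • (1 : Matrix (Fin 5) (Fin 5) R)).det = -z * (z ^ 2 + c) ^ 2 := by
  have h : !![0, 0, -c, 0, 0;
        0, 0, 0, -c, 0;
        1, 0, 0, 0, 0;
        0, 1, 0, 0, 0;
        0, 0, 0, 0, 0] - z • (1 : Matrix (Fin 5) (Fin 5) R) =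
      !![-z, 0, -c, 0, 0;
        0, -z, 0, -c, 0;
        1, 0, -z, 0, 0;
        0, 1, 0, -z, 0;
        0, 0, 0, 0, -z] := by
    ext i j
    fin_cases i <;> fin_cases j <;> simp
  rw [h]
  simp [Matrix.det_succ_row_zero, Fin.sum_univ_succ, Fin.succAbove]
  ring

/-- For `α > 0`, every complex eigenvalue of the Jacobian of the linearized zero
dynamics of the UAV-with-payload model has zero real part, and the eigenvalues are
exactly `0` and `± i·√(g/α)`: the linearized zero dynamics are marginally stable
when the controlled output lies above the combined center of gravity. -/
theorem zero_dynamics_marginally_stable_above (g α : ℝ) (hg : 0 < g) (hα : 0 < α)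
    (J : Matrix (Fin 5) (Fin 5) ℝ)
    (hJ : J = !![0, 0, -g/α, 0, 0;
                 0, 0, 0, -g/α, 0;
                 1, 0, 0, 0, 0;
                 0, 1, 0, 0, 0;
                 0, 0, 0, 0, 0]) :
    (∀ z : ℂ, (J.map (Complex.ofReal) - z • (1 : Matrix (Fin 5) (Fin 5) ℂ)).det = 0 →
        z.re = 0) ∧
    (∀ z : ℂ, (J.map (Complex.ofReal) - z • (1 : Matrix (Fin 5) (Fin 5) ℂ)).det = 0 ↔
        (z = 0 ∨ z = Complex.I * (Real.sqrt (g/α) : ℂ) ∨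
          z = -(Complex.I * (Real.sqrt (g/α) : ℂ)))) := by
  have hdet : ∀ z : ℂ, (J.map (Complex.ofReal) - z • (1 : Matrix (Fin 5) (Fin 5) ℂ)).det = 0 ↔
      (z = 0 ∨ z = Complex.I * (Real.sqrt (g/α) : ℂ) ∨
        z = -(Complex.I * (Real.sqrt (g/α) : ℂ))) := by
    intro z
    have hmap : J.map Complex.ofReal =
        !![0, 0, -((g/α : ℝ) : ℂ), 0, 0;
           0, 0, 0, -((g/α : ℝ) : ℂ), 0;
           1, 0, 0, 0, 0;
           0, 1, 0, 0, 0;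
           0, 0, 0, 0, 0] := by
      subst hJ
      ext i j
      fin_cases i <;> fin_cases j <;> simp [neg_div]
    have hsq : ((g/α : ℝ) : ℂ) = -(Complex.I * (Real.sqrt (g/α) : ℂ)) ^ 2 := by
      rw [mul_pow, Complex.I_sq, ← Complex.ofReal_pow, Real.sq_sqrt (div_pos hg hα).le]
      ring
    rw [hmap, det_zero_dynamics_jacobian_sub_smul_one, mul_eq_zero, neg_eq_zero,
      sq_eq_zero_iff, hsq, ← sub_eq_add_neg, sub_eq_zero, sq_eq_sq_iff_eq_or_eq_neg]
  refine ⟨fun z hz => ?_, hdet⟩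
  rcases (hdet z).1 hz with rfl | rfl | rfl <;> simp
end

section
/- Fix real numbers g > 0, q̂ > 0 and α, set a = √(2g·q̂⁷), and define the 4×4 symmetric real matrix P₁ with entries p₁₁ = √(2/g)·√(a − α·q̂⁴ + √(a² + (a − α·q̂⁴)²)), p₁₂ = p₁₁²/(2q̂²), p₂₂ = (3/(8q̂⁴))·p₁₁³ + (α/(2g))·p₁₁ − q̂³/(g·p₁₁), p₁₃ = (g/(2q̂⁴))·p₁₁³ − g·p₂₂, p₁₄ = q̂ − (α/(2q̂²))·p₁₁², p₂₃ = (g/(8q̂⁶))·p₁₁⁴, p₂₄ = p₁₁/q̂ − α·p₂₂, p₃₃ = (g/(2q̂⁴))·p₁₁²·((g/(2q̂⁴))·p₁₁³ − g·p₂₂) − (g/q̂)·p₁₁ + α·g·p₂₂, p₃₄ = (g/(2q̂³))·p₁₁² − (α·g/(8q̂⁶))·p₁₁⁴, p₄₄ = (g/(2q̂⁵))·p₁₁³ − (g/q̂)·p₂₂ − α·(p₁₁/q̂ − α·p₂₂) (and pⱼᵢ = pᵢⱼ). Let A₁ be the 4×4 matrix whose only nonzero entries are A₁(1,2) = 1,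 A₁(2,3) = g, A₁(3,4) = 1, let B₁ = (0, α, 0, 1)ᵀ, and let Q₁ = diag(q̂², 0, 0, 0). Then P₁ satisfies the algebraic Riccati equation A₁ᵀ·P₁ + P₁·A₁ − P₁·B₁·B₁ᵀ·P₁ + Q₁ = 0. (Note p₁₁ > 0, so all entries are well defined.) -/
open Matrix

/-- The quartic in `p₁₁ ^ 2` to which the last diagonal entry of the Riccati equation reduces. -/
lemma riccati_quartic_of_quadratic {g q α a y p : ℝ} (hg : 0 < g)
    (ha : a ^ 2 = 2 * g * q ^ 7) (hp : g * p ^ 2 = 2 * y)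
    (hy : y ^ 2 = 2 * (a - α * q ^ 4) * y + a ^ 2) :
    g ^ 2 * p ^ 8 + 8 * α * g * q ^ 4 * p ^ 6 + (16 * α ^ 2 * q ^ 8 - 48 * g * q ^ 7) * p ^ 4
      - 64 * α * q ^ 11 * p ^ 2 + 64 * q ^ 14 = 0 := by
  have hfac : y ^ 4 + 4 * (α * q ^ 4) * y ^ 3 + (4 * (α * q ^ 4) ^ 2 - 6 * a ^ 2) * y ^ 2
      - 4 * (α * q ^ 4) * a ^ 2 * y + (a ^ 2) ^ 2 = 0 := by
    linear_combination (y ^ 2 + 2 * (a + α * q ^ 4) * y - a ^ 2) * hy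
  rw [ha] at hfac
  obtain rfl : y = g * p ^ 2 / 2 := by linarith
  have hg2 : g ^ 2 ≠ 0 := by positivity
  apply mul_left_cancel₀ hg2
  linear_combination 16 * hfac

lemma replicateCol_mul_transpose {n : Type*} (v : n → ℝ) :
    Matrix.replicateCol (Fin 1) v * (Matrix.replicateCol (Fin 1) v)ᵀ = Matrix.vecMulVec v v := by
  ext i j
  simp [Matrix.mul_apply, Matrix.vecMulVec_apply]

/-- Entrywise form of the Riccati equation: `c₁, c₂, c₃, c₄` are the entries of the gain `P * B`. -/
lemma riccati_of_gain {g α c₁ c₂ c₃ c₄ p11 p12 p13 p14 p22 p23 p24 p33 p34 p44 : ℝ}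
    (k1 : α * p12 + p14 = c₁) (k2 : α * p22 + p24 = c₂)
    (k3 : α * p23 + p34 = c₃) (k4 : α * p24 + p44 = c₄)
    (e12 : c₁ * c₂ = p11) (e13 : g * p12 = c₁ * c₃) (e14 : c₁ * c₄ = p13)
    (e22 : 2 * p12 = c₂ ^ 2) (e23 : p13 + g * p22 = c₂ * c₃) (e24 : p14 + p23 = c₂ * c₄)
    (e33 : 2 * g * p23 = c₃ ^ 2) (e34 : p33 + g * p24 = c₃ * c₄) (e44 : 2 * p34 = c₄ ^ 2) :
    (!![0, 1, 0, 0; 0, 0, g, 0; 0, 0, 0, 1; 0, 0, 0, 0] : Matrix (Fin 4) (Fin 4) ℝ)ᵀ *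
        !![p11, p12, p13, p14; p12, p22, p23, p24; p13, p23, p33, p34; p14, p24, p34, p44]
      + !![p11, p12, p13, p14; p12, p22, p23, p24; p13, p23, p33, p34; p14, p24, p34, p44] *
        !![0, 1, 0, 0; 0, 0, g, 0; 0, 0, 0, 1; 0, 0, 0, 0]
      - !![p11, p12, p13, p14; p12, p22, p23, p24; p13, p23, p33, p34; p14, p24, p34, p44] *
        (!![0; α; 0; 1] : Matrix (Fin 4) (Fin 1) ℝ) *
        (!![0; α; 0; 1] : Matrix (Fin 4) (Fin 1) ℝ)ᵀ *
        !![p11, p12, p13, p14; p12, p22, p23, p24; p13, p23, p33, p34; p14, p24, p34, p44]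
      + Matrix.diagonal ![c₁ ^ 2, 0, 0, 0] = 0 := by
  have hPB : !![p11, p12, p13, p14; p12, p22, p23, p24; p13, p23, p33, p34; p14, p24, p34, p44] *
      (!![0; α; 0; 1] : Matrix (Fin 4) (Fin 1) ℝ) = Matrix.replicateCol (Fin 1) ![c₁, c₂, c₃, c₄] := by
    ext i j
    fin_cases i <;> fin_cases j <;> simp [Matrix.mul_apply, Fin.sum_univ_four] <;> linarith
  have hPt : (!![p11, p12, p13, p14; p12, p22, p23, p24; p13, p23, p33, p34;
      p14, p24, p34, p44])ᵀ =
      !![p11, p12, p13, p14; p12, p22, p23, p24; p13, p23, p33, p34; p14, p24, p34, p44] := by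
    ext i j
    fin_cases i <;> fin_cases j <;> rfl
  have hBP := congrArg Matrix.transpose hPB
  rw [Matrix.transpose_mul, hPt] at hBP
  rw [Matrix.mul_assoc (_ * _), hBP, hPB, replicateCol_mul_transpose]
  ext i j
  fin_cases i <;> fin_cases j <;>
    simp [Matrix.mul_apply, Fin.sum_univ_four, Matrix.diagonal] <;> linarith

/-- The closed-form matrix `P₁` solves the algebraic Riccati equation
`A₁ᵀP₁ + P₁A₁ − P₁B₁B₁ᵀP₁ + Q₁ = 0` for the horizontal subsystem of the
UAV-with-payload model linearized about hover (Proposition 1 of the paper). -/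
theorem horizontal_riccati_solution
    (g q α a p11 p12 p13 p14 p22 p23 p24 p33 p34 p44 : ℝ)
    (hg : 0 < g) (hq : 0 < q)
    (ha : a = Real.sqrt (2 * g * q ^ 7))
    (h11 : p11 = Real.sqrt (2 / g) *
      Real.sqrt (a - α * q ^ 4 + Real.sqrt (a ^ 2 + (a - α * q ^ 4) ^ 2)))
    (h12 : p12 = p11 ^ 2 / (2 * q ^ 2))
    (h22 : p22 = 3 / (8 * q ^ 4) * p11 ^ 3 + α / (2 * g) * p11 - q ^ 3 / (g * p11))
    (h13 : p13 = g / (2 * q ^ 4) * p11 ^ 3 - g * p22)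
    (h14 : p14 = q - α / (2 * q ^ 2) * p11 ^ 2)
    (h23 : p23 = g / (8 * q ^ 6) * p11 ^ 4)
    (h24 : p24 = p11 / q - α * p22)
    (h33 : p33 = g / (2 * q ^ 4) * p11 ^ 2 * (g / (2 * q ^ 4) * p11 ^ 3 - g * p22)
      - g / q * p11 + α * g * p22)
    (h34 : p34 = g / (2 * q ^ 3) * p11 ^ 2 - α * g / (8 * q ^ 6) * p11 ^ 4)
    (h44 : p44 = g / (2 * q ^ 5) * p11 ^ 3 - g / q * p22 - α * (p11 / q - α * p22))
    (P : Matrix (Fin 4) (Fin 4) ℝ)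
    (hP : P = !![p11, p12, p13, p14;
                 p12, p22, p23, p24;
                 p13, p23, p33, p34;
                 p14, p24, p34, p44])
    (A : Matrix (Fin 4) (Fin 4) ℝ)
    (hA : A = !![0, 1, 0, 0;
                 0, 0, g, 0;
                 0, 0, 0, 1;
                 0, 0, 0, 0])
    (B : Matrix (Fin 4) (Fin 1) ℝ) (hB : B = !![0; α; 0; 1])
    (Q : Matrix (Fin 4) (Fin 4) ℝ) (hQ : Q = Matrix.diagonal ![q ^ 2, 0, 0, 0]) :
    Aᵀ * P + P * A - P * B * Bᵀ * P + Q = 0 := by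
  have hq0 : q ≠ 0 := hq.ne'
  have hg0 : g ≠ 0 := hg.ne'
  have ha_pos : 0 < a := by rw [ha]; positivity
  have ha2 : a ^ 2 = 2 * g * q ^ 7 := by rw [ha]; exact Real.sq_sqrt (by positivity)
  set b := a - α * q ^ 4 with hb
  set s := Real.sqrt (a ^ 2 + b ^ 2) with hs
  have hs2 : s ^ 2 = a ^ 2 + b ^ 2 := Real.sq_sqrt (by positivity)
  have hbs : |b| < s := by
    rw [hs, ← Real.sqrt_sq_eq_abs]
    exact Real.sqrt_lt_sqrt (sq_nonneg b) (by nlinarith)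
  have hy_pos : 0 < b + s := by linarith [neg_abs_le b]
  have hp_pos : 0 < p11 := by rw [h11]; positivity
  have hp0 : p11 ≠ 0 := hp_pos.ne'
  have hp2 : g * p11 ^ 2 = 2 * (b + s) := by
    rw [h11, mul_pow, Real.sq_sqrt (by positivity), Real.sq_sqrt hy_pos.le]
    field_simp
  have hquartic := riccati_quartic_of_quadratic (α := α) hg ha2 hp2
    (by rw [← hb]; linear_combination hs2)
  clear_value b s
  have k1 : α * p12 + p14 = q := by rw [h12, h14]; ring
  have k2 : α * p22 + p24 = p11 / q := by rw [h24]; ring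
  have k3 : α * p23 + p34 = g * p11 ^ 2 / (2 * q ^ 3) := by
    rw [h23, h34]; ring
  have k4 : α * p24 + p44 = p13 / q := by
    rw [h24, h44, h13]; field_simp; ring
  have h13' : p13 = g * p11 ^ 3 / (8 * q ^ 4) - α * p11 / 2 + q ^ 3 / p11 := by
    rw [h13, h22]; field_simp; ring
  have e22 : 2 * p12 = (p11 / q) ^ 2 := by rw [h12]; field_simp
  have e13 : g * p12 = q * (g * p11 ^ 2 / (2 * q ^ 3)) := by rw [h12]; field_simp
  have e23 : p13 + g * p22 = p11 / q * (g * p11 ^ 2 / (2 * q ^ 3)) := by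
    rw [h13]; field_simp; ring
  have e24 : p14 + p23 = p11 / q * (p13 / q) := by
    rw [h14, h23, h13']; field_simp; ring
  have e33 : 2 * g * p23 = (g * p11 ^ 2 / (2 * q ^ 3)) ^ 2 := by
    rw [h23]; field_simp; ring
  have e34 : p33 + g * p24 = g * p11 ^ 2 / (2 * q ^ 3) * (p13 / q) := by
    rw [h33, h24, h13]; field_simp; ring
  have e44 : 2 * p34 = (p13 / q) ^ 2 := by
    rw [h34, h13']; field_simp; linear_combination -4 * hquartic
  have e12 : q * (p11 / q) = p11 := by field_simp
  have e14 : q * (p13 / q) = p13 := by field_simp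
  rw [hP, hA, hB, hQ]
  exact riccati_of_gain k1 k2 k3 k4 e12 e13 e14 e22 e23 e24 e33 e34 e44
end

section
/- Fix real numbers g > 0, q̂ > 0 and α, set a = √(2g·q̂⁷), and let P₁ be the 4×4 symmetric real matrix with entries p₁₁ = √(2/g)·√(a − α·q̂⁴ + √(a² + (a − α·q̂⁴)²)), p₁₂ = p₁₁²/(2q̂²), p₂₂ = (3/(8q̂⁴))·p₁₁³ + (α/(2g))·p₁₁ − q̂³/(g·p₁₁), p₁₃ = (g/(2q̂⁴))·p₁₁³ − g·p₂₂, p₁₄ = q̂ − (α/(2q̂²))·p₁₁², p₂₃ = (g/(8q̂⁶))·p₁₁⁴, p₂₄ = p₁₁/q̂ − α·p₂₂, p₃₃ = (g/(2q̂⁴))·p₁₁²·((g/(2q̂⁴))·p₁₁³ − g·p₂₂) − (g/q̂)·p₁₁ + α·g·p₂₂, p₃₄ = (g/(2q̂³))·p₁₁² − (α·g/(8q̂⁶))·p₁₁⁴, p₄₄ = (g/(2q̂⁵))·p₁₁³ − (g/q̂)·p₂₂ − α·(p₁₁/q̂ − α·p₂₂). Then P₁ is positive semidefinite, i.e. xᵀ·P₁·x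 ≥ 0 for all x ∈ ℝ⁴. -/
open Matrix

/-- The root `s = √(2/g) · √(c + √(a² + c²))` is positive, and `g s² / 2` solves
`u² - 2 c u = a²`. -/
lemma nested_sqrt_pos_and_quadratic {g a c s : ℝ} (hg : 0 < g) (ha : 0 < a)
    (hs : s = Real.sqrt (2 / g) * Real.sqrt (c + Real.sqrt (a ^ 2 + c ^ 2))) :
    0 < s ∧ (g * s ^ 2 / 2) ^ 2 - 2 * c * (g * s ^ 2 / 2) = a ^ 2 := by
  have hr : Real.sqrt (a ^ 2 + c ^ 2) ^ 2 = a ^ 2 + c ^ 2 := Real.sq_sqrt (by positivity)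
  have hc : 0 < c + Real.sqrt (a ^ 2 + c ^ 2) := by
    have : -c < Real.sqrt (a ^ 2 + c ^ 2) := Real.lt_sqrt_of_sq_lt (by nlinarith [pow_pos ha 2])
    linarith
  have hu : g * s ^ 2 / 2 = c + Real.sqrt (a ^ 2 + c ^ 2) := by
    rw [hs, mul_pow, Real.sq_sqrt (by positivity), Real.sq_sqrt hc.le]
    field_simp
  refine ⟨hs ▸ by positivity, ?_⟩
  rw [hu]
  linear_combination hr

/-- The closed-form Riccati solution `P₁` for the horizontal subsystem of the
UAV-with-payload model linearized about hover is positive semidefinite: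
`xᵀ·P₁·x ≥ 0` for all `x ∈ ℝ⁴`. -/
theorem horizontal_riccati_solution_posSemidef
    (g q α a p11 p12 p13 p14 p22 p23 p24 p33 p34 p44 : ℝ)
    (hg : 0 < g) (hq : 0 < q)
    (ha : a = Real.sqrt (2 * g * q ^ 7))
    (h11 : p11 = Real.sqrt (2 / g) *
      Real.sqrt (a - α * q ^ 4 + Real.sqrt (a ^ 2 + (a - α * q ^ 4) ^ 2)))
    (h12 : p12 = p11 ^ 2 / (2 * q ^ 2))
    (h22 : p22 = 3 / (8 * q ^ 4) * p11 ^ 3 + α / (2 * g) * p11 - q ^ 3 / (g * p11))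
    (h13 : p13 = g / (2 * q ^ 4) * p11 ^ 3 - g * p22)
    (h14 : p14 = q - α / (2 * q ^ 2) * p11 ^ 2)
    (h23 : p23 = g / (8 * q ^ 6) * p11 ^ 4)
    (h24 : p24 = p11 / q - α * p22)
    (h33 : p33 = g / (2 * q ^ 4) * p11 ^ 2 * (g / (2 * q ^ 4) * p11 ^ 3 - g * p22)
      - g / q * p11 + α * g * p22)
    (h34 : p34 = g / (2 * q ^ 3) * p11 ^ 2 - α * g / (8 * q ^ 6) * p11 ^ 4)
    (h44 : p44 = g / (2 * q ^ 5) * p11 ^ 3 - g / q * p22 - α * (p11 / q - α * p22))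
    (P : Matrix (Fin 4) (Fin 4) ℝ)
    (hP : P = !![p11, p12, p13, p14;
                 p12, p22, p23, p24;
                 p13, p23, p33, p34;
                 p14, p24, p34, p44]) :
    ∀ x : Fin 4 → ℝ, 0 ≤ x ⬝ᵥ (P *ᵥ x) := by
  have ha_pos : 0 < a := by rw [ha]; positivity
  have ha_sq : a ^ 2 = 2 * g * q ^ 7 := by rw [ha]; exact Real.sq_sqrt (by positivity)
  obtain ⟨hp, hquad⟩ := nested_sqrt_pos_and_quadratic hg ha_pos h11
  clear h11 ha
  obtain ⟨m, hm, rfl⟩ : ∃ m : ℝ, 0 < m ∧ m ^ 4 = q :=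
    ⟨q ^ (1 / 4 : ℝ), by positivity, by rw [← Real.rpow_natCast, ← Real.rpow_mul hq.le]; norm_num⟩
  obtain ⟨n, hn, rfl⟩ : ∃ n : ℝ, 0 < n ∧ 2 * n ^ 4 = g :=
    ⟨(g / 2) ^ (1 / 4 : ℝ), by positivity, by
      rw [← Real.rpow_natCast, ← Real.rpow_mul (by positivity)]; norm_num; ring⟩
  obtain ⟨t, ht, rfl⟩ : ∃ t : ℝ, 0 < t ∧ t * m ^ 7 / n = p11 :=
    ⟨p11 * n / m ^ 7, by positivity, by field_simp⟩
  obtain rfl : a = 2 * n ^ 2 * m ^ 14 :=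
    (pow_left_inj₀ ha_pos.le (by positivity) two_ne_zero).1 (by rw [ha_sq]; ring)
  have hα : α = n ^ 2 / m ^ 2 * (2 - t ^ 2 / 2 + 2 / t ^ 2) := by
    field_simp at hquad ⊢
    linear_combination hquad
  clear hquad ha_sq ha_pos
  intro x
  have key : x ⬝ᵥ (P *ᵥ x) = m ^ 7 / n *
      (t * (x 0 + t / 2 * (x 1 / (n * m)) + (t ^ 2 / 2 - 1) * (n ^ 2 / m ^ 2 * x 2)
          + (t ^ 3 / 4 - t) * (n / m ^ 3 * x 3)) ^ 2
        + t / 2 * (x 1 / (n * m) + t * (n ^ 2 / m ^ 2 * x 2)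
          + (t ^ 2 / 2 - 1 - 2 / t ^ 2) * (n / m ^ 3 * x 3)) ^ 2
        + 2 / t * (n ^ 2 / m ^ 2 * x 2 + t / 2 * (n / m ^ 3 * x 3)) ^ 2
        + 1 / t * (n / m ^ 3 * x 3) ^ 2) := by
    rw [hP, h33, h44, h34, h24, h23, h14, h13, h12, h22, hα]
    simp [Matrix.mulVec, dotProduct, Fin.sum_univ_four]
    field_simp
    ring
  rw [key]
  positivity
end

section
/- Fix real numbers g > 0, q̂ > 0 and α. Set a = √(2g·q̂⁷), b = α·q̂⁴ and σ = √((a − b)² + a²), and let P₁ be the 4×4 symmetric real matrix with entries p₁₁ = √(2/g)·√(a − b + √(a² + (a − b)²)), p₁₂ = p₁₁²/(2q̂²), p₂₂ = (3/(8q̂⁴))·p₁₁³ + (α/(2g))·p₁₁ − q̂³/(g·p₁₁), p₁₃ = (g/(2q̂⁴))·p₁₁³ − g·p₂₂, p₁₄ = q̂ − (α/(2q̂²))·p₁₁², p₂₃ = (g/(8q̂⁶))·p₁₁⁴, p₂₄ = p₁₁/q̂ − α·p₂₂, p₃₃ = (g/(2q̂⁴))·p₁₁²·((g/(2q̂⁴))·p₁₁³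 − g·p₂₂) − (g/q̂)·p₁₁ + α·g·p₂₂, p₃₄ = (g/(2q̂³))·p₁₁² − (α·g/(8q̂⁶))·p₁₁⁴, p₄₄ = (g/(2q̂⁵))·p₁₁³ − (g/q̂)·p₂₂ − α·(p₁₁/q̂ − α·p₂₂). With B₁ = (0, α, 0, 1)ᵀ, the scalar B₁ᵀ·P₁·B₁ = α²·p₂₂ + 2α·p₂₄ + p₄₄ equals (2a − b + σ)/(q̂^{3/2}·√(a − b + σ)). -/
open Matrix

/-- Analytical H₂-norm expression (Proposition 2 of the paper): for the horizontal
subsystem of the UAV-with-payload model linearized about hover with closed-form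
Riccati solution `P₁` and input vector `B₁ = (0, α, 0, 1)ᵀ`, the scalar
`B₁ᵀ·P₁·B₁ = α²p₂₂ + 2αp₂₄ + p₄₄` equals `(2a − b + σ)/(q̂^(3/2)·√(a − b + σ))`,
where `a = √(2g q̂⁷)`, `b = α q̂⁴`, `σ = √((a − b)² + a²)`. -/
theorem horizontal_h2_norm_formula
    (g q α a b σ p11 p12 p13 p14 p22 p23 p24 p33 p34 p44 : ℝ)
    (hg : 0 < g) (hq : 0 < q)
    (ha : a = Real.sqrt (2 * g * q ^ 7))
    (hb : b = α * q ^ 4)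
    (hσ : σ = Real.sqrt ((a - b) ^ 2 + a ^ 2))
    (h11 : p11 = Real.sqrt (2 / g) *
      Real.sqrt (a - b + Real.sqrt (a ^ 2 + (a - b) ^ 2)))
    (h12 : p12 = p11 ^ 2 / (2 * q ^ 2))
    (h22 : p22 = 3 / (8 * q ^ 4) * p11 ^ 3 + α / (2 * g) * p11 - q ^ 3 / (g * p11))
    (h13 : p13 = g / (2 * q ^ 4) * p11 ^ 3 - g * p22)
    (h14 : p14 = q - α / (2 * q ^ 2) * p11 ^ 2)
    (h23 : p23 = g / (8 * q ^ 6) * p11 ^ 4)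
    (h24 : p24 = p11 / q - α * p22)
    (h33 : p33 = g / (2 * q ^ 4) * p11 ^ 2 * (g / (2 * q ^ 4) * p11 ^ 3 - g * p22)
      - g / q * p11 + α * g * p22)
    (h34 : p34 = g / (2 * q ^ 3) * p11 ^ 2 - α * g / (8 * q ^ 6) * p11 ^ 4)
    (h44 : p44 = g / (2 * q ^ 5) * p11 ^ 3 - g / q * p22 - α * (p11 / q - α * p22))
    (P : Matrix (Fin 4) (Fin 4) ℝ)
    (hP : P = !![p11, p12, p13, p14;
                 p12, p22, p23, p24;
                 p13, p23, p33, p34;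
                 p14, p24, p34, p44])
    (B : Matrix (Fin 4) (Fin 1) ℝ) (hB : B = !![0; α; 0; 1]) :
    (Bᵀ * P * B) 0 0 = α ^ 2 * p22 + 2 * α * p24 + p44 ∧
      α ^ 2 * p22 + 2 * α * p24 + p44 =
        (2 * a - b + σ) / (q ^ ((3 : ℝ) / 2) * Real.sqrt (a - b + σ)) := by
  constructor
  · subst hP hB
    simp [Matrix.mul_apply, Fin.sum_univ_four]
    ring
  · obtain ⟨r, hr, rfl⟩ : ∃ r : ℝ, 0 < r ∧ q = r ^ 2 :=
      ⟨√q, Real.sqrt_pos.2 hq, (Real.sq_sqrt hq.le).symm⟩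
    obtain ⟨k, hk, hk_sq, hk_def⟩ : ∃ k : ℝ, 0 < k ∧ g * k ^ 2 = 2 ∧ √(2 / g) = k := by
      refine ⟨√(2 / g), Real.sqrt_pos.2 (by positivity), ?_, rfl⟩
      rw [Real.sq_sqrt (by positivity)]
      field_simp
    have ha_eq : a = g * k * r ^ 7 := by
      rw [ha, show 2 * g * (r ^ 2) ^ 7 = (g * k * r ^ 7) ^ 2 by rw [← hk_sq]; ring]
      exact Real.sqrt_sq (by positivity)
    have ha_pos : 0 < a := by rw [ha_eq]; positivity
    have hσ_sq : σ ^ 2 = (a - b) ^ 2 + a ^ 2 := by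
      rw [hσ]
      exact Real.sq_sqrt (by positivity)
    have hσ_nonneg : 0 ≤ σ := hσ ▸ Real.sqrt_nonneg _
    have hs : 0 < a - b + σ := by nlinarith
    rw [add_comm (a ^ 2), ← hσ, hk_def] at h11
    have hrpow : (r ^ 2) ^ ((3 : ℝ) / 2) = r ^ 3 := by
      rw [← Real.rpow_natCast r 2, ← Real.rpow_mul hr.le, ← Real.rpow_natCast r 3]
      norm_num
    rw [hrpow]
    obtain ⟨t, ht, ht_sq, ht_def⟩ : ∃ t : ℝ, 0 < t ∧ t ^ 2 = a - b + σ ∧ √(a - b + σ) = t :=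
      ⟨_, Real.sqrt_pos.2 hs, Real.sq_sqrt hs.le, rfl⟩
    rw [ht_def] at h11 ⊢
    have hquad : t ^ 4 = 2 * (a - b) * t ^ 2 + a ^ 2 := by
      linear_combination (t ^ 2 + σ - (a - b)) * ht_sq + hσ_sq
    have hnum : 2 * a - b + σ = a + t ^ 2 := by linear_combination -ht_sq
    have hp : 0 < p11 := by rw [h11]; positivity
    have hreduce : α ^ 2 * p22 + 2 * α * p24 + p44 =
        α * p11 / (2 * r ^ 2) + g * p11 ^ 3 / (8 * r ^ 10) + r ^ 4 / p11 := by
      rw [h44, h24, h22]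
      field_simp
      ring
    have hg_eq : g = 2 / k ^ 2 := by
      field_simp
      exact hk_sq
    rw [hreduce, hnum, h11]
    subst hg_eq hb ha_eq
    field_simp at hquad ⊢
    linear_combination 4 * hquad
end

section
/- Let a > 0 be a real number. For b ∈ ℝ define σ(b) = √((a − b)² + a²) and f(b) = (2a − b + σ(b))/√(a − b + σ(b)) (the quantity a − b + σ(b) is strictly positive for every b, so f is well defined). Then f(b) ≥ 2√a for all b ∈ ℝ, with equality if and only if b = a; i.e. f attains a strict global minimum at b = a with minimum value 2√a. -/
/-- The defect in the AM-GM inequality `2√a ≤ (a + t)/√t`. -/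
theorem add_div_sqrt_sub_two_mul_sqrt {a t : ℝ} (ha : 0 ≤ a) (ht : 0 < t) :
    (a + t) / √t - 2 * √a = (√t - √a) ^ 2 / √t := by
  have h : √t ≠ 0 := (Real.sqrt_pos.2 ht).ne'
  rw [sub_sq, Real.sq_sqrt ha, Real.sq_sqrt ht.le]
  field_simp
  ring

/-- The function `f(b) = (2a − b + σ(b))/√(a − b + σ(b))`, with
`σ(b) = √((a − b)² + a²)`, is well defined (its denominator's radicand is positive)
and attains a strict global minimum `2√a` at `b = a`. -/
theorem h2_expression_global_min (a : ℝ) (ha : 0 < a)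
    (σ f : ℝ → ℝ)
    (hσ : ∀ b, σ b = Real.sqrt ((a - b) ^ 2 + a ^ 2))
    (hf : ∀ b, f b = (2 * a - b + σ b) / Real.sqrt (a - b + σ b)) :
    (∀ b, 0 < a - b + σ b) ∧
      (∀ b, 2 * Real.sqrt a ≤ f b) ∧
      (∀ b, f b = 2 * Real.sqrt a ↔ b = a) := by
  have hpos : ∀ b, 0 < a - b + σ b := fun b => by
    have h : |a - b| < σ b := by
      rw [hσ, ← Real.sqrt_sq_eq_abs]
      exact Real.sqrt_lt_sqrt (sq_nonneg _) (by linarith [pow_pos ha 2])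
    linarith [neg_abs_le (a - b)]
  have hgap : ∀ b, f b - 2 * √a = (√(a - b + σ b) - √a) ^ 2 / √(a - b + σ b) := fun b => by
    rw [hf, ← add_div_sqrt_sub_two_mul_sqrt ha.le (hpos b)]
    ring
  refine ⟨hpos, fun b => ?_, fun b => ?_⟩
  · rw [← sub_nonneg, hgap]
    positivity
  · rw [← sub_eq_zero, hgap, div_eq_zero_iff, or_iff_left (Real.sqrt_pos.2 (hpos b)).ne',
      sq_eq_zero_iff, sub_eq_zero, Real.sqrt_inj (hpos b).le ha.le]
    constructor
    · intro h
      have hsq : σ b ^ 2 = (a - b) ^ 2 + a ^ 2 := by rw [hσ, Real.sq_sqrt (by positivity)]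
      have hb : σ b = b := by linarith
      rw [hb] at hsq
      exact mul_left_cancel₀ ha.ne' (by linarith)
    · rintro rfl
      rw [hσ, sub_self, zero_pow two_ne_zero, zero_add, zero_add, Real.sqrt_sq ha.le]
end

section
/- Let a > 0 be a real number. For b ∈ ℝ define σ(b) = √((a − b)² + a²) and f(b) = (2a − b + σ(b))/√(a − b + σ(b)). Then f is strictly decreasing on (−∞, a] and strictly increasing on [a, ∞). -/
theorem neg_lt_sqrt_sq_add_sq {a : ℝ} (ha : 0 < a) (x : ℝ) : -x < Real.sqrt (x ^ 2 + a ^ 2) :=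
  Real.lt_sqrt_of_sq_lt (by nlinarith)

theorem strictMono_add_sqrt_sq_add_sq {a : ℝ} (ha : 0 < a) :
    StrictMono fun x : ℝ => x + Real.sqrt (x ^ 2 + a ^ 2) := by
  intro y x hyx
  have hx := neg_lt_sqrt_sq_add_sq ha x
  have hy := neg_lt_sqrt_sq_add_sq ha y
  have hxs := Real.sq_sqrt (by positivity : 0 ≤ x ^ 2 + a ^ 2)
  have hys := Real.sq_sqrt (by positivity : 0 ≤ y ^ 2 + a ^ 2)
  have hS : 0 < Real.sqrt (x ^ 2 + a ^ 2) := Real.sqrt_pos.2 (by positivity)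
  have hT : 0 < Real.sqrt (y ^ 2 + a ^ 2) := Real.sqrt_pos.2 (by positivity)
  dsimp only
  generalize Real.sqrt (x ^ 2 + a ^ 2) = S at *
  generalize Real.sqrt (y ^ 2 + a ^ 2) = T at *
  by_contra! h
  nlinarith [mul_pos (sub_pos.2 hyx) (by linarith : 0 < S + T + x + y),
    mul_nonneg (sub_nonneg.2 h) (add_pos hS hT).le]

theorem strictMonoOn_add_div_self {a : ℝ} (ha : 0 < a) :
    StrictMonoOn (fun w : ℝ => w + a / w) (Set.Ici (Real.sqrt a)) := by
  intro u hu w _ huw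
  have hs := Real.sqrt_pos.2 ha
  have hu' : Real.sqrt a ≤ u := hu
  have hu0 : 0 < u := hs.trans_le hu'
  have hw0 : 0 < w := hu0.trans huw
  have hau : a ≤ u ^ 2 := (Real.sqrt_le_left hu0.le).1 hu'
  have key : w + a / w - (u + a / u) = (w - u) * (u * w - a) / (u * w) := by
    field_simp
    ring
  have : 0 < (w - u) * (u * w - a) / (u * w) :=
    div_pos (mul_pos (sub_pos.2 huw) (by nlinarith)) (mul_pos hu0 hw0)
  dsimp only
  linarith

theorem strictAntiOn_add_div_self {a : ℝ} (ha : 0 < a) :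
    StrictAntiOn (fun w : ℝ => w + a / w) (Set.Ioc 0 (Real.sqrt a)) := by
  intro u hu w hw huw
  have hu0 : 0 < u := hu.1
  have hw0 : 0 < w := hw.1
  have hwa : w ^ 2 ≤ a := (Real.le_sqrt hw0.le ha.le).1 hw.2
  have key : u + a / u - (w + a / w) = (w - u) * (a - u * w) / (u * w) := by
    field_simp
    ring
  have : 0 < (w - u) * (a - u * w) / (u * w) :=
    div_pos (mul_pos (sub_pos.2 huw) (by nlinarith)) (mul_pos hu0 hw0)
  dsimp only
  linarith

/-- The squared H₂-norm expression `f(b) = (2a − b + σ(b))/√(a − b + σ(b))`, with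
`σ(b) = √((a − b)² + a²)`, is strictly decreasing on `(−∞, a]` and strictly
increasing on `[a, ∞)`. -/
theorem h2_expression_monotonicity (a : ℝ) (ha : 0 < a)
    (σ f : ℝ → ℝ)
    (hσ : ∀ b, σ b = Real.sqrt ((a - b) ^ 2 + a ^ 2))
    (hf : ∀ b, f b = (2 * a - b + σ b) / Real.sqrt (a - b + σ b)) :
    StrictAntiOn f (Set.Iic a) ∧ StrictMonoOn f (Set.Ici a) := by
  have hpos : ∀ b, 0 < a - b + σ b := fun b => by
    have := neg_lt_sqrt_sq_add_sq ha (a - b)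
    rw [hσ]
    linarith
  have hv : StrictAnti fun b => a - b + σ b := fun b c hbc => by
    simpa only [hσ] using strictMono_add_sqrt_sq_add_sq ha (sub_lt_sub_left hbc a)
  have hva : a - a + σ a = a := by simp [hσ, Real.sqrt_sq ha.le]
  have hw : StrictAnti fun b => Real.sqrt (a - b + σ b) := fun b c hbc =>
    Real.sqrt_lt_sqrt (hpos c).le (hv hbc)
  have hfw : f = (fun w : ℝ => w + a / w) ∘ fun b => Real.sqrt (a - b + σ b) := by
    funext b
    have hs := Real.sqrt_pos.2 (hpos b)
    have hsq := Real.sq_sqrt (hpos b).le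
    rw [hf, Function.comp_apply, div_eq_iff hs.ne', add_mul, div_mul_cancel₀ _ hs.ne']
    linarith
  rw [hfw]
  constructor
  · refine (strictMonoOn_add_div_self ha).comp_strictAntiOn (hw.strictAntiOn _) fun b hb => ?_
    simpa only [hva, Set.mem_Ici] using hw.antitone (Set.mem_Iic.1 hb)
  · refine (strictAntiOn_add_div_self ha).comp (hw.strictAntiOn _) fun b hb =>
      ⟨Real.sqrt_pos.2 (hpos b), ?_⟩
    simpa only [hva] using hw.antitone (Set.mem_Ici.1 hb)
end

section
/- Let g > 0 and q̂ > 0 be real numbers and set a = √(2g·q̂⁷). For α ∈ ℝ define σ(α) = √((a − α·q̂⁴)² + a²) and T(α) = (2a − α·q̂⁴ + σ(α))/(q̂^{3/2}·√(a − α·q̂⁴ + σ(α))). Then T attains a strict global minimum at α* = √(2g/q̂): T(α) ≥ T(α*) for all α ∈ ℝ, with equality if and only if α = √(2g/q̂). -/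
/-- The real AM-GM inequality in ratio form: `w ↦ (a + w) / √w` is at least `2√a`. -/
lemma two_mul_sqrt_le_add_div_sqrt {a w : ℝ} (ha : 0 < a) (hw : 0 < w) :
    2 * √a ≤ (a + w) / √w := by
  rw [le_div_iff₀ (Real.sqrt_pos.2 hw)]
  nlinarith [sq_nonneg (√a - √w), Real.sq_sqrt ha.le, Real.sq_sqrt hw.le]

lemma add_div_sqrt_eq_two_mul_sqrt_iff {a w : ℝ} (ha : 0 < a) (hw : 0 < w) :
    (a + w) / √w = 2 * √a ↔ w = a := by
  rw [div_eq_iff (Real.sqrt_pos.2 hw).ne', ← Real.sqrt_inj hw.le ha.le]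
  constructor
  · intro h
    have : (√w - √a) ^ 2 = 0 := by
      linear_combination h + Real.sq_sqrt ha.le + Real.sq_sqrt hw.le
    exact sub_eq_zero.1 (pow_eq_zero_iff two_ne_zero |>.1 this)
  · intro h
    linear_combination -Real.sq_sqrt ha.le - Real.sq_sqrt hw.le + (√w - √a) * h

lemma add_sqrt_sq_add_sq_pos {a : ℝ} (ha : 0 < a) (u : ℝ) : 0 < u + √(u ^ 2 + a ^ 2) := by
  have h : |u| < √(u ^ 2 + a ^ 2) := Real.lt_sqrt_of_sq_lt (by rw [sq_abs]; nlinarith)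
  linarith [neg_abs_le u]

lemma add_sqrt_sq_add_sq_eq_iff {a : ℝ} (ha : 0 < a) (u : ℝ) :
    u + √(u ^ 2 + a ^ 2) = a ↔ u = 0 := by
  constructor
  · intro h
    have hs := Real.sq_sqrt (by positivity : 0 ≤ u ^ 2 + a ^ 2)
    rw [show √(u ^ 2 + a ^ 2) = a - u by linarith] at hs
    have : a * u = 0 := by linarith
    exact (mul_eq_zero.1 this).resolve_left ha.ne'
  · rintro rfl
    simp [Real.sqrt_sq ha.le]

/-- Theorem 2 of the paper: the squared H₂-norm
`T(α) = (2a − αq̂⁴ + σ(α))/(q̂^(3/2)·√(a − αq̂⁴ + σ(α)))`, with `a = √(2g q̂⁷)` and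
`σ(α) = √((a − αq̂⁴)² + a²)`, attains a strict global minimum at `α* = √(2g/q̂)`. -/
theorem h2_optimal_alpha (g q : ℝ) (hg : 0 < g) (hq : 0 < q)
    (a : ℝ) (ha : a = Real.sqrt (2 * g * q ^ 7))
    (σ T : ℝ → ℝ)
    (hσ : ∀ α, σ α = Real.sqrt ((a - α * q ^ 4) ^ 2 + a ^ 2))
    (hT : ∀ α, T α = (2 * a - α * q ^ 4 + σ α) /
      (q ^ ((3 : ℝ) / 2) * Real.sqrt (a - α * q ^ 4 + σ α))) :
    (∀ α, T (Real.sqrt (2 * g / q)) ≤ T α) ∧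
      (∀ α, T α = T (Real.sqrt (2 * g / q)) ↔ α = Real.sqrt (2 * g / q)) := by
  have ha0 : 0 < a := ha ▸ Real.sqrt_pos.2 (by positivity)
  have hc : 0 < q ^ ((3 : ℝ) / 2) := Real.rpow_pos_of_pos hq _
  have hw (α : ℝ) : 0 < a - α * q ^ 4 + σ α := hσ α ▸ add_sqrt_sq_add_sq_pos ha0 _
  have hT' (α : ℝ) : T α =
      (a + (a - α * q ^ 4 + σ α)) / √(a - α * q ^ 4 + σ α) / q ^ ((3 : ℝ) / 2) := by
    rw [hT, div_div, mul_comm (q ^ _)]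
    ring
  have hstar : √(2 * g / q) * q ^ 4 = a := by
    rw [ha, show 2 * g * q ^ 7 = 2 * g / q * (q ^ 4) ^ 2 by field_simp,
      Real.sqrt_mul (by positivity), Real.sqrt_sq (by positivity)]
  have heq (α : ℝ) : T α = 2 * √a / q ^ ((3 : ℝ) / 2) ↔ α = √(2 * g / q) := by
    rw [hT', div_left_inj' hc.ne', add_div_sqrt_eq_two_mul_sqrt_iff ha0 (hw α), hσ,
      add_sqrt_sq_add_sq_eq_iff ha0, sub_eq_zero, ← hstar,
      mul_left_inj' (pow_pos hq 4).ne', eq_comm]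
  rw [(heq _).2 rfl]
  refine ⟨fun α => ?_, heq⟩
  rw [hT']
  exact div_le_div_of_nonneg_right (two_mul_sqrt_le_add_div_sqrt ha0 (hw α)) hc.le
end

section
/- Let a > 0 and b̄ > 0 be real numbers, and set σ₁ = √((a + b̄)² + a²) and σ₂ = √((a − b̄)² + a²). Then (2a + b̄ + σ₁)/√(a + b̄ + σ₁) > (2a − b̄ + σ₂)/√(a − b̄ + σ₂) (both denominators are strictly positive). Consequently, the squared H₂-norm of the linearized UAV-with-payload subsystem is strictly smaller when the controlled output lies above the combined center of gravity (α = b̄/q̂⁴ > 0) than when it lies the same distance below (α = −b̄/q̂⁴ < 0). -/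
/-- The function `u ↦ (a + u) / √u` takes a larger value at `u` than at `v`
whenever `0 < v < u` and `a ^ 2 < u * v`. -/
theorem add_div_sqrt_lt_add_div_sqrt {a u v : ℝ} (hv : 0 < v) (huv : v < u)
    (h : a ^ 2 < u * v) : (a + v) / √v < (a + u) / √u := by
  have hu : 0 < u := hv.trans huv
  have hlt : √v < √u := Real.sqrt_lt_sqrt hv.le huv
  have ha : a < √u * √v := by
    rw [← Real.sqrt_mul hu.le]
    exact Real.lt_sqrt_of_sq_lt h
  rw [div_lt_div_iff₀ (Real.sqrt_pos.2 hv) (Real.sqrt_pos.2 hu)]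
  have key : (a + u) * √v - (a + v) * √u = (√u - √v) * (√u * √v - a) := by
    linear_combination -√v * Real.sq_sqrt hu.le + √u * Real.sq_sqrt hv.le
  have := mul_pos (sub_pos.2 hlt) (sub_pos.2 ha)
  linarith


/-- Theorem 3 of the paper: with `σ₁ = √((a + b̄)² + a²)` and `σ₂ = √((a − b̄)² + a²)`
for `a > 0`, `b̄ > 0`, the below-configuration squared H₂-norm exceeds the
above-configuration one:
`(2a + b̄ + σ₁)/√(a + b̄ + σ₁) > (2a − b̄ + σ₂)/√(a − b̄ + σ₂)`. -/
theorem h2_below_gt_above (a b : ℝ) (ha : 0 < a) (hb : 0 < b)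
    (σ₁ σ₂ : ℝ)
    (hσ₁ : σ₁ = Real.sqrt ((a + b) ^ 2 + a ^ 2))
    (hσ₂ : σ₂ = Real.sqrt ((a - b) ^ 2 + a ^ 2)) :
    (2 * a - b + σ₂) / Real.sqrt (a - b + σ₂) <
      (2 * a + b + σ₁) / Real.sqrt (a + b + σ₁) := by
  have hσ : σ₂ < σ₁ := by
    rw [hσ₁, hσ₂]
    exact Real.sqrt_lt_sqrt (by positivity) (by nlinarith [mul_pos ha hb])
  have habs : |a - b| < σ₂ := by
    rw [hσ₂]
    exact Real.lt_sqrt_of_sq_lt (by rw [sq_abs]; linarith [pow_pos ha 2])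
  have hv : 0 < a - b + σ₂ := by linarith [neg_abs_le (a - b)]
  have hsq : σ₂ ^ 2 = (a - b) ^ 2 + a ^ 2 := by
    rw [hσ₂]
    exact Real.sq_sqrt (by positivity)
  have hprod : a ^ 2 < (a + b + σ₁) * (a - b + σ₂) :=
    calc a ^ 2 = (σ₂ - (a - b)) * (a - b + σ₂) := by linear_combination -hsq
      _ < (a + b + σ₁) * (a - b + σ₂) := mul_lt_mul_of_pos_right (by linarith) hv
  convert add_div_sqrt_lt_add_div_sqrt hv (by linarith) hprod using 2 <;> ring
end

section
/- Let a > 0 and b̄ ≥ 0 be real numbers, and set σ₁ = √((a + b̄)² + a²) and σ₂ = √((a − b̄)² + a²). Then (a + b̄ + σ₁)·(a − b̄ + σ₂) > a². -/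
/-- Key inequality `B₁·B₂ > a²` in the proof of Theorem 3 of the paper:
with `σ₁ = √((a + b̄)² + a²)` and `σ₂ = √((a − b̄)² + a²)`, for `a > 0` and `b̄ ≥ 0`,
`(a + b̄ + σ₁)·(a − b̄ + σ₂) > a²`. -/
theorem key_product_inequality (a b : ℝ) (ha : 0 < a) (hb : 0 ≤ b)
    (σ₁ σ₂ : ℝ)
    (hσ₁ : σ₁ = Real.sqrt ((a + b) ^ 2 + a ^ 2))
    (hσ₂ : σ₂ = Real.sqrt ((a - b) ^ 2 + a ^ 2)) :
    a ^ 2 < (a + b + σ₁) * (a - b + σ₂) := by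
  have hle : σ₂ ≤ σ₁ := by
    rw [hσ₁, hσ₂]
    exact Real.sqrt_le_sqrt (by nlinarith [mul_nonneg ha.le hb])
  have hsq : σ₂ ^ 2 = (a - b) ^ 2 + a ^ 2 := by
    rw [hσ₂, Real.sq_sqrt (by positivity)]
  have hpos : 0 < a - b + σ₂ := by
    have : b - a < σ₂ := by
      rw [hσ₂]
      exact Real.lt_sqrt_of_sq_lt (by nlinarith [pow_pos ha 2])
    linarith
  have hprod : 0 < (a - b + σ₂) * (2 * a + σ₁ - σ₂) := mul_pos hpos (by linarith)
  linear_combination hprod - hsq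
end
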